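/- arXiv:1903.07996 — 2 statements merged into one kernel-verified Lean document; each statement's English description precedes it below -/
import Mathlib

section
/- Let A be a normal ℤ_{≥0}-graded finitely generated ℂ-algebra with A₀ = ℂ (a normal quasicone). Then the Picard group of X = Spec A is trivial. -/
open DirectSum Finset

/-- **Gauss's lemma for valuations**: if all coefficients of a product of two finitely supported
sequences have valuation at most `b`, then so do all products of their coefficients. -/
theorem Valuation.map_mul_le_of_forall_map_sum_antidiagonal_le {R Γ : Type*} [Ring R]
    [LinearOrderedCommGroupWithZero Γ] (v : Valuation R Γ) {p q : ℕ → R}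
    (hp : p.support.Finite) (hq : q.support.Finite) {b : Γ}
    (h : ∀ n, v (∑ ij ∈ antidiagonal n, p ij.1 * q ij.2) ≤ b) (i j : ℕ) :
    v (p i * q j) ≤ b := by
  classical
  have exists_least_max : ∀ {r : ℕ → R}, r.support.Finite →
      ∃ m, (∀ k, v (r k) ≤ v (r m)) ∧ ∀ k < m, v (r k) < v (r m) := by
    intro r hr
    have hmax : ∃ m, ∀ k, v (r k) ≤ v (r m) := by
      obtain ⟨m, -, hm⟩ := (insert 0 hr.toFinset).exists_max_image (fun k ↦ v (r k))
        (insert_nonempty _ _)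
      refine ⟨m, fun k ↦ ?_⟩
      by_cases hk : r k = 0
      · simp [hk]
      · exact hm k (by simp [hk])
    refine ⟨Nat.find hmax, Nat.find_spec hmax, fun k hk ↦ ?_⟩
    have := Nat.find_min hmax hk
    push Not at this
    obtain ⟨l, hl⟩ := this
    exact hl.trans_le (Nat.find_spec hmax l)
  obtain ⟨i₀, hi₀, hi₀'⟩ := exists_least_max hp
  obtain ⟨j₀, hj₀, hj₀'⟩ := exists_least_max hq
  have hle : v (p i * q j) ≤ v (p i₀ * q j₀) := by
    rw [map_mul, map_mul]
    exact mul_le_mul' (hi₀ i) (hj₀ j)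
  refine hle.trans ?_
  by_cases h0 : v (p i₀ * q j₀) = 0
  · simp [h0]
  refine le_of_eq_of_le ?_ (h (i₀ + j₀))
  rw [map_mul, mul_eq_zero, not_or] at h0
  rw [← add_sum_erase _ _ (HasAntidiagonal.mem_antidiagonal.mpr rfl :
      (i₀, j₀) ∈ antidiagonal (i₀ + j₀)),
    Valuation.map_add_eq_of_lt_left]
  refine v.map_sum_lt (by simp [h0]) fun ⟨k, l⟩ hkl ↦ ?_
  rw [mem_erase, HasAntidiagonal.mem_antidiagonal] at hkl
  obtain ⟨hne, hkl⟩ := hkl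
  simp only at hkl
  rw [map_mul, map_mul]
  rcases lt_trichotomy k i₀ with hk | rfl | hk
  · exact mul_lt_mul_of_lt_of_le_of_nonneg_of_pos (hi₀' k hk) (hj₀ l) zero_le
      (zero_lt_iff.mpr h0.2)
  · exact absurd (by simp; omega) hne
  · exact mul_lt_mul_of_le_of_lt_of_nonneg_of_pos (hi₀ k) (hj₀' l (by omega)) zero_le
      (zero_lt_iff.mpr h0.1)

/-- A form of the Dedekind–Kronecker theorem: over an integrally closed domain, if `s` divides all
coefficients of a product of two finitely supported sequences, then it divides all products of
their coefficients. -/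
theorem IsIntegrallyClosed.dvd_mul_of_forall_dvd_sum_antidiagonal {A : Type*} [CommRing A]
    [IsDomain A] [IsIntegrallyClosed A] {p q : ℕ → A} (hp : p.support.Finite)
    (hq : q.support.Finite) {s : A} (hs : s ≠ 0)
    (h : ∀ n, s ∣ ∑ ij ∈ antidiagonal n, p ij.1 * q ij.2) (i j : ℕ) : s ∣ p i * q j := by
  let K := FractionRing A
  let φ := algebraMap A K
  have hs' : φ s ≠ 0 := by simpa [φ] using hs
  suffices IsIntegral A (φ (p i * q j) / φ s) by
    obtain ⟨t, ht⟩ := IsIntegrallyClosed.isIntegral_iff.mp this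
    refine ⟨t, IsFractionRing.injective A K ?_⟩
    change φ _ = φ _
    rw [map_mul φ s, ht, mul_div_cancel₀ _ hs']
  by_contra hmem
  rw [← mem_integralClosure_iff, ← Subalgebra.mem_toSubring] at hmem
  obtain ⟨V, hV, hxV⟩ := Subring.exists_le_valuationSubring_of_isIntegrallyClosedIn hmem
  refine hxV ?_
  have hle : ∀ a, V.valuation (φ a) ≤ 1 := fun a ↦ (V.valuation_le_one_iff _).mpr
    (hV (algebraMap_mem (integralClosure A K) a))
  rw [← V.valuation_le_one_iff, map_div₀]
  refine div_le_one_of_le₀ ?_ zero_le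
  refine (V.valuation.comap φ).map_mul_le_of_forall_map_sum_antidiagonal_le hp hq
    (b := V.valuation (φ s)) (fun n ↦ ?_) i j
  obtain ⟨t, ht⟩ := h n
  rw [ht, Valuation.comap_apply, map_mul, map_mul]
  exact mul_le_of_le_one_right' (hle t)

/-- An ideal contained in a principal ideal is a multiple of it. -/
theorem Ideal.exists_span_singleton_mul_eq {A : Type*} [CommRing A] {f : A} {I : Ideal A}
    (h : I ≤ Ideal.span {f}) : ∃ J : Ideal A, Ideal.span {f} * J = I := by
  refine ⟨Submodule.comap (LinearMap.mulLeft A f) I, le_antisymm ?_ fun x hx ↦ ?_⟩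
  · rw [Ideal.span_singleton_mul_le_iff]
    exact fun z hz ↦ hz
  · obtain ⟨y, rfl⟩ := Ideal.mem_span_singleton.mp (h hx)
    exact Ideal.mem_span_singleton_mul.mpr ⟨y, hx, rfl⟩

namespace GradedRing

variable {A σ : Type*} [CommRing A] [SetLike σ A] [AddSubgroupClass σ A]
  (𝒜 : ℕ → σ) [GradedRing 𝒜]

theorem dvd_coe_decompose_of_dvd {s z : A} {d : ℕ} (hs : s ∈ 𝒜 d) (h : s ∣ z) (n : ℕ) :
    s ∣ (decompose 𝒜 z n : A) := by
  obtain ⟨t, rfl⟩ := h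
  rw [coe_decompose_mul_of_left_mem 𝒜 n hs]
  split_ifs
  · exact dvd_mul_right _ _
  · exact dvd_zero _

theorem dvd_of_forall_dvd_coe_decompose {s z : A} (h : ∀ n, s ∣ (decompose 𝒜 z n : A)) :
    s ∣ z := by
  classical
  rw [← sum_support_decompose 𝒜 z]
  exact dvd_sum fun n _ ↦ h n

theorem finite_support_coe_decompose (x : A) :
    (fun i ↦ (decompose 𝒜 x i : A)).support.Finite := by
  classical
  refine (decompose 𝒜 x).support.finite_toSet.subset fun i hi ↦ ?_
  simpa using hi

theorem coe_decompose_mul_eq_sum_antidiagonal (x y : A) (n : ℕ) :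
    (decompose 𝒜 (x * y) n : A) =
      ∑ ij ∈ antidiagonal n, (decompose 𝒜 x ij.1 : A) * decompose 𝒜 y ij.2 := by
  rw [decompose_mul, coe_mul_apply_eq_sum_antidiagonal]

variable [IsDomain A]

/-- In an integrally closed graded domain, a homogeneous divisor of `x * y` divides all products of
homogeneous components of `x` and `y`. -/
theorem dvd_coe_decompose_mul_coe_decompose [IsIntegrallyClosed A] {s x y : A} {d : ℕ}
    (hs : s ∈ 𝒜 d) (hs0 : s ≠ 0) (h : s ∣ x * y) (i j : ℕ) :
    s ∣ (decompose 𝒜 x i : A) * decompose 𝒜 y j :=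
  IsIntegrallyClosed.dvd_mul_of_forall_dvd_sum_antidiagonal
    (finite_support_coe_decompose 𝒜 x) (finite_support_coe_decompose 𝒜 y) hs0
    (fun n ↦ coe_decompose_mul_eq_sum_antidiagonal 𝒜 x y n ▸ dvd_coe_decompose_of_dvd 𝒜 hs h n) i j

/-- An ideal of an integrally closed graded domain is principal if it is invertible and contains a
nonzero homogeneous element, provided that the degree zero part is a field. -/
theorem isPrincipal_of_mul_eq_span_of_mem [IsIntegrallyClosed A]
    (h0 : ∀ r ∈ 𝒜 0, r ≠ 0 → IsUnit r) {I J : Ideal A} {s : A} {d : ℕ} (hs : s ∈ 𝒜 d)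
    (hs0 : s ≠ 0) (hIJ : I * J = Ideal.span {s}) : I.IsPrincipal := by
  have hdvd : ∀ x ∈ I, ∀ y ∈ J, ∀ i j, s ∣ (decompose 𝒜 x i : A) * decompose 𝒜 y j :=
    fun x hx y hy i j ↦ dvd_coe_decompose_mul_coe_decompose 𝒜 hs hs0
      (Ideal.mem_span_singleton.mp (hIJ ▸ Ideal.mul_mem_mul hx hy)) i j
  obtain ⟨x, hx, y, hy, i, j, hij, hne⟩ : ∃ x ∈ I, ∃ y ∈ J, ∃ i j, i + j = d ∧
      (decompose 𝒜 x i : A) * decompose 𝒜 y j ≠ 0 := by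
    by_contra! hzero
    refine hs0 ?_
    rw [← decompose_of_mem_same 𝒜 hs]
    have hsIJ : s ∈ I * J := hIJ ▸ Ideal.mem_span_singleton_self s
    refine Submodule.mul_induction_on hsIJ (fun x hx y hy ↦ ?_) (fun x y hx hy ↦ ?_)
    · rw [coe_decompose_mul_eq_sum_antidiagonal]
      exact sum_eq_zero fun ij hij ↦
        hzero x hx y hy _ _ (HasAntidiagonal.mem_antidiagonal.mp hij)
    · rw [decompose_add, DirectSum.add_apply, AddMemClass.coe_add, hx, hy, add_zero]
  obtain ⟨u, hu, hxy⟩ : ∃ u : A, IsUnit u ∧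
      (decompose 𝒜 x i : A) * decompose 𝒜 y j = s * u := by
    obtain ⟨r, hr⟩ := hdvd x hx y hy i j
    have hmem : s * r ∈ 𝒜 (d + 0) := by
      rw [← hr, add_zero, ← hij]
      exact SetLike.mul_mem_graded (SetLike.coe_mem _) (SetLike.coe_mem _)
    have hr' : s * r = s * decompose 𝒜 r 0 := by
      rw [← coe_decompose_mul_add_of_left_mem 𝒜 hs, decompose_of_mem_same 𝒜 hmem]
    refine ⟨decompose 𝒜 r 0, h0 _ (SetLike.coe_mem _) fun h ↦ hne ?_, hr.trans hr'⟩
    rw [hr, hr', h, mul_zero]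
  set a : A := (decompose 𝒜 x i : A)
  set b : A := (decompose 𝒜 y j : A)
  have hb : b ≠ 0 := right_ne_zero_of_mul hne
  refine ⟨a, le_antisymm (fun z hz ↦ ?_) ?_⟩
  · refine Ideal.mem_span_singleton.mpr <| dvd_of_forall_dvd_coe_decompose 𝒜 fun n ↦ ?_
    rw [← mul_dvd_mul_iff_right hb, hxy, hu.mul_right_dvd]
    exact hdvd z hz y hy n j
  · rw [Ideal.submodule_span_eq, Ideal.span_singleton_le_iff_mem]
    have haJ : Ideal.span {a} * J ≤ I * J := by
      rw [hIJ, Ideal.span_singleton_mul_le_iff]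
      exact fun w hw ↦ Ideal.mem_span_singleton.mpr <| by
        classical
        rw [← sum_support_decompose 𝒜 w, mul_sum]
        exact dvd_sum fun n _ ↦ hdvd x hx w hw i n
    have := Ideal.mul_mono_left (K := I) haJ
    rw [mul_assoc, mul_assoc, mul_comm J I, hIJ, mul_comm, mul_comm I,
      Ideal.span_singleton_mul_right_mono hs0, Ideal.span_singleton_le_iff_mem] at this
    exact this

/-- After inverting the nonzero homogeneous elements, every ideal of a graded domain is generated by
an element with the narrowest range of degrees. -/
theorem exists_forall_exists_dvd_mul {I : Ideal A} (hI : I ≠ ⊥) :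
    ∃ f ∈ I, f ≠ 0 ∧ ∀ x ∈ I, ∃ s, SetLike.IsHomogeneousElem 𝒜 s ∧ s ≠ 0 ∧ f ∣ s * x := by
  classical
  let Supp (x : A) (m w : ℕ) : Prop := ∀ i, (decompose 𝒜 x i : A) ≠ 0 → m ≤ i ∧ i < m + w
  have exists_supp : ∃ w, ∃ f ∈ I, f ≠ 0 ∧ ∃ n, Supp f n w := by
    obtain ⟨f, hf, hf0⟩ := Submodule.exists_mem_ne_zero_of_ne_bot hI
    obtain ⟨N, hN⟩ := (finite_support_coe_decompose 𝒜 f).bddAbove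
    exact ⟨N + 1, f, hf, hf0, 0, fun i hi ↦ ⟨i.zero_le, by have := hN hi; omega⟩⟩
  let w := Nat.find exists_supp
  obtain ⟨f, hf, hf0, n, hfn⟩ := Nat.find_spec exists_supp
  change Supp f n w at hfn
  have eq_zero : ∀ x ∈ I, ∀ m k, k < w → Supp x m k → x = 0 := fun x hx m k hk hxm ↦ by
    by_contra hx0
    exact Nat.find_min exists_supp hk ⟨x, hx, hx0, m, hxm⟩
  have supp_zero : ∀ x m, Supp x m 0 → x = 0 := fun x m hx ↦ by
    rw [← sum_support_decompose 𝒜 x]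
    refine sum_eq_zero fun i _ ↦ ?_
    by_contra hi
    have := hx i hi
    omega
  have supp_pred : ∀ x m k, Supp x m (k + 1) → (decompose 𝒜 x (m + k) : A) = 0 → Supp x m k :=
    fun x m k hx hxk i hi ↦ by
      have := hx i hi
      have : i ≠ m + k := by rintro rfl; exact hi hxk
      omega
  have supp_mul : ∀ t e x m k, t ∈ 𝒜 e → Supp x m k → Supp (t * x) (e + m) k :=
    fun t e x m k ht hx i hi ↦ by
      rw [coe_decompose_mul_of_left_mem 𝒜 i ht] at hi
      split_ifs at hi with hei
      · have := hx _ (right_ne_zero_of_mul hi)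
        omega
      · exact absurd rfl hi
  obtain ⟨v, hv⟩ : ∃ v, w = v + 1 := Nat.exists_eq_succ_of_ne_zero fun hw ↦
    hf0 (supp_zero f n (hw ▸ hfn))
  have hlead : (decompose 𝒜 f (n + v) : A) ≠ 0 := fun h ↦
    hf0 (eq_zero f hf n v (by omega) (supp_pred f n v (hv ▸ hfn) h))
  refine ⟨f, hf, hf0, fun x hx ↦ ?_⟩
  suffices ∀ k, ∀ x ∈ I, ∀ m, Supp x m k →
      ∃ s, SetLike.IsHomogeneousElem 𝒜 s ∧ s ≠ 0 ∧ f ∣ s * x by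
    obtain ⟨N, hN⟩ := (finite_support_coe_decompose 𝒜 x).bddAbove
    exact this (N + 1) x hx 0 fun i hi ↦ ⟨i.zero_le, by have := hN hi; omega⟩
  intro k
  induction k with
  | zero =>
    intro x _ m hxm
    exact ⟨1, SetLike.isHomogeneousElem_one 𝒜, one_ne_zero, by simp [supp_zero x m hxm]⟩
  | succ k ih =>
    intro x hx m hxm
    rcases lt_or_ge (k + 1) w with hk | hk
    · exact ⟨1, SetLike.isHomogeneousElem_one 𝒜, one_ne_zero, by
        simp [eq_zero x hx m _ hk hxm]⟩
    set a : A := (decompose 𝒜 f (n + v) : A)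
    set b : A := (decompose 𝒜 x (m + k) : A)
    have ha : a ∈ 𝒜 (n + v) := SetLike.coe_mem _
    have hb : b ∈ 𝒜 (m + k) := SetLike.coe_mem _
    have hsupp : Supp (a * x - b * f) (n + v + m) k := by
      refine supp_pred _ _ _ (fun i hi ↦ ?_) ?_
      · rw [decompose_sub, DirectSum.sub_apply, AddSubgroupClass.coe_sub] at hi
        have h1 := supp_mul a _ x m _ ha hxm i
        have h2 := supp_mul b _ f n _ hb hfn i
        by_cases h : (decompose 𝒜 (a * x) i : A) = 0
        · have := h2 fun h' ↦ hi (by rw [h, h', sub_zero])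
          omega
        · exact h1 h
      · rw [decompose_sub, DirectSum.sub_apply, AddSubgroupClass.coe_sub,
          add_assoc (n + v), coe_decompose_mul_add_of_left_mem 𝒜 ha, add_comm (n + v),
          coe_decompose_mul_add_of_left_mem 𝒜 hb, mul_comm, sub_self]
    obtain ⟨s, hs, hs0, hdvd⟩ :=
      ih _ (I.sub_mem (I.mul_mem_left a hx) (I.mul_mem_left b hf)) _ hsupp
    refine ⟨s * a, hs.mul ⟨_, ha⟩, mul_ne_zero hs0 hlead, ?_⟩
    have : s * a * x = s * (a * x - b * f) + f * (s * b) := by ring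
    rw [this]
    exact dvd_add hdvd (dvd_mul_right _ _)

/-- A finitely generated invertible ideal of an integrally closed graded domain whose degree zero
part is a field is principal. -/
theorem isPrincipal_of_mul_eq_span [IsIntegrallyClosed A] (h0 : ∀ r ∈ 𝒜 0, r ≠ 0 → IsUnit r)
    {I J : Ideal A} (hfg : I.FG) {c : A} (hc : c ≠ 0) (hIJ : I * J = Ideal.span {c}) :
    I.IsPrincipal := by
  have hI : I ≠ ⊥ := by
    rintro rfl
    rw [Ideal.bot_mul, eq_comm, Ideal.span_singleton_eq_bot] at hIJ
    exact hc hIJ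
  obtain ⟨f, hf, hf0, hdvd⟩ := exists_forall_exists_dvd_mul 𝒜 hI
  obtain ⟨s, ⟨d, hsd⟩, hs0, hs⟩ : ∃ s, SetLike.IsHomogeneousElem 𝒜 s ∧ s ≠ 0 ∧
      Ideal.span {s} * I ≤ Ideal.span {f} := by
    choose! s hs hs0 hsf using hdvd
    obtain ⟨T, rfl⟩ := hfg
    have hT : ∀ t ∈ T, t ∈ Ideal.span (T : Set A) := fun t ht ↦ Ideal.subset_span ht
    refine ⟨∏ t ∈ T, s t, (SetLike.homogeneousSubmonoid 𝒜).prod_mem fun t ht ↦ hs t (hT t ht),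
      prod_ne_zero_iff.mpr fun t ht ↦ hs0 t (hT t ht), ?_⟩
    rw [Ideal.span_mul_span', Ideal.span_le]
    rintro _ ⟨_, rfl, t, ht, rfl⟩
    exact Ideal.mem_span_singleton.mpr
      ((hsf t (hT t ht)).trans (mul_dvd_mul_right (dvd_prod_of_mem s ht) t))
  obtain ⟨I', hI'⟩ := Ideal.exists_span_singleton_mul_eq hs
  have hsI' : Ideal.span {s} ≤ I' := by
    rw [← Ideal.span_singleton_mul_right_mono hf0, hI', mul_comm (Ideal.span {f})]
    exact Ideal.mul_mono_right ((Ideal.span_singleton_le_iff_mem _).mpr hf)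
  have hI'J : I' * (Ideal.span {f} * J) = Ideal.span {s} * Ideal.span {c} := by
    rw [← mul_assoc, mul_comm I', hI', mul_assoc, hIJ]
  obtain ⟨J', hJ'⟩ := Ideal.exists_span_singleton_mul_eq <|
    (Ideal.span_singleton_mul_right_mono hs0).mp <| (Ideal.mul_mono_left hsI').trans hI'J.le
  have hI'J' : I' * J' = Ideal.span {s} := by
    rw [← Ideal.span_singleton_mul_right_inj hc, mul_left_comm, hJ', hI'J, mul_comm]
  obtain ⟨g, rfl⟩ := isPrincipal_of_mul_eq_span_of_mem 𝒜 h0 hsd hs0 hI'J'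
  rw [Ideal.submodule_span_eq, Ideal.span_singleton_mul_span_singleton] at hI'
  obtain ⟨z, -, hz⟩ := Ideal.mem_span_singleton_mul.mp (hI' ▸ Ideal.mem_span_singleton_self (f * g))
  rw [← hz, ← Ideal.span_singleton_mul_span_singleton,
    Ideal.span_singleton_mul_right_inj hs0] at hI'
  exact ⟨z, hI'.symm⟩

end GradedRing

/-- The class group of a domain is trivial as soon as all invertible ideals are principal. -/
theorem ClassGroup.subsingleton_of_forall_isPrincipal {A : Type*} [CommRing A] [IsDomain A]
    (h : ∀ (I J : Ideal A) (c : A), c ≠ 0 → I * J = Ideal.span {c} → I.IsPrincipal) :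
    Subsingleton (ClassGroup A) := by
  refine subsingleton_of_forall_eq 1 fun x ↦ ?_
  refine ClassGroup.induction (FractionRing A) (fun I ↦ ?_) x
  rw [ClassGroup.mk_eq_one_iff]
  refine FractionalIdeal.isPrincipal_of_isPrincipal_num _ (h _ I⁻¹.val.num
    (I.val.den * I⁻¹.val.den) (nonZeroDivisors.coe_ne_zero (I.val.den * I⁻¹.val.den)) ?_)
  apply FractionalIdeal.coeIdeal_injective (K := FractionRing A)
  simp only [FractionalIdeal.coeIdeal_mul, FractionalIdeal.coeIdeal_span_singleton, map_mul,
    ← FractionalIdeal.den_mul_self_eq_num']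
  rw [mul_mul_mul_comm, I.mul_inv, mul_one, FractionalIdeal.spanSingleton_mul_spanSingleton]

theorem picardGroup_trivial_of_normal_quasicone
    (A : Type) [CommRing A] [IsDomain A] [IsIntegrallyClosed A] [Algebra ℂ A]
    (𝒜 : ℕ → Submodule ℂ A) [GradedAlgebra 𝒜]
    (hfg : Algebra.FiniteType ℂ A)
    (h0 : (𝒜 0 : Set A) = Set.range (algebraMap ℂ A)) :
    Subsingleton (ClassGroup A) := by
  have := hfg.isNoetherianRing
  refine ClassGroup.subsingleton_of_forall_isPrincipal fun I J c hc hIJ ↦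
    GradedRing.isPrincipal_of_mul_eq_span 𝒜 (fun r hr hr0 ↦ ?_) (IsNoetherian.noetherian I) hc hIJ
  obtain ⟨z, rfl⟩ : r ∈ Set.range (algebraMap ℂ A) := h0 ▸ hr
  exact (IsUnit.mk0 z fun hz ↦ hr0 (by rw [hz, map_zero])).map _
end

section
/- Let R be an integral domain graded by a finitely generated abelian group K, and suppose R is factorially K-graded (every nonzero homogeneous nonunit is a product of K-prime homogeneous elements). If K' is another finitely generated abelian group with the same torsion subgroup as K and the grading of R by K is refined or coarsened only in the free part (i.e. K and K' differ by a homomorphism that is an isomorphism on torsion), then R is factorially K'-graded. -/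
/-!
STATEMENT 11 (Bechtold): Let `R` be an integral domain graded by a finitely generated
abelian group `K`, and factorially `K`-graded.  If `K'` is a finitely generated abelian
group and the grading is coarsened along a homomorphism `φ : K → K'` which changes only
the free part, i.e. restricts to an isomorphism of the torsion subgroups, then `R` is
factorially `K'`-graded (with respect to the coarsened grading).
-/

/-- homogeneity w.r.t. an additive-subgroup-valued grading -/
def IsHomogA {K R : Type} [AddCommGroup K] [CommRing R]
    (𝒜 : K → AddSubgroup R) (f : R) : Prop :=
  ∃ k : K, f ∈ 𝒜 k

/-- `f` is `K`-prime for the grading `𝒜`. -/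
def IsGradedPrimeA {K R : Type} [AddCommGroup K] [CommRing R]
    (𝒜 : K → AddSubgroup R) (f : R) : Prop :=
  IsHomogA 𝒜 f ∧ f ≠ 0 ∧ ¬IsUnit f ∧
    ∀ g h : R, IsHomogA 𝒜 g → IsHomogA 𝒜 h → f ∣ g * h → f ∣ g ∨ f ∣ h

/-- `R` is factorially `K`-graded: every nonzero homogeneous nonunit is a product of
`K`-prime homogeneous elements. -/
def FactoriallyGradedA {K R : Type} [AddCommGroup K] [CommRing R]
    (𝒜 : K → AddSubgroup R) : Prop :=
  ∀ f : R, IsHomogA 𝒜 f → f ≠ 0 → ¬IsUnit f →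
    ∃ s : Multiset R, (∀ g ∈ s, IsGradedPrimeA 𝒜 g) ∧ f = s.prod

/-- The grading coarsened along `φ : K →+ K'`. -/
def coarsenGrading {K K' R : Type} [AddCommGroup K] [AddCommGroup K'] [CommRing R]
    (φ : K →+ K') (𝒜 : K → AddSubgroup R) : K' → AddSubgroup R :=
  fun w => ⨆ k ∈ φ ⁻¹' {w}, 𝒜 k


open DirectSum

section GradedDomain

variable {K R : Type} [AddCommGroup K] [DecidableEq K] [CommRing R]
  (𝒜 : K → AddSubgroup R) [GradedRing 𝒜]

theorem eq_of_decompose_coe_eq {x y : R}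
    (h : ∀ k, (decompose 𝒜 x k : R) = decompose 𝒜 y k) : x = y :=
  (decompose 𝒜).injective (DFinsupp.ext fun k => Subtype.ext (h k))

theorem mem_of_decompose_eq_zero {x : R} {k : K}
    (h : ∀ i, i ≠ k → (decompose 𝒜 x i : R) = 0) : x ∈ 𝒜 k := by
  have : x = decompose 𝒜 x k := by
    refine eq_of_decompose_coe_eq 𝒜 fun i => ?_
    by_cases hi : i = k
    · subst hi
      rw [decompose_of_mem_same 𝒜 (decompose 𝒜 x i).2]
    · rw [h i hi, decompose_of_mem_ne 𝒜 (decompose 𝒜 x k).2 (Ne.symm hi)]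
  rw [this]
  exact (decompose 𝒜 x k).2

theorem exists_decompose_ne_zero {x : R} (hx : x ≠ 0) : ∃ k, (decompose 𝒜 x k : R) ≠ 0 := by
  by_contra! h
  exact hx (eq_of_decompose_coe_eq 𝒜 fun k => by rw [h k, decompose_zero]; rfl)

theorem dvd_of_forall_dvd_decompose {p x : R} (h : ∀ k, p ∣ (decompose 𝒜 x k : R)) : p ∣ x := by
  classical
  rw [← sum_support_decompose 𝒜 x]
  exact Finset.dvd_sum fun k _ => h k

theorem dvd_decompose_of_dvd {p x : R} (hp : IsHomogA 𝒜 p) (h : p ∣ x) (k : K) :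
    p ∣ (decompose 𝒜 x k : R) := by
  obtain ⟨d, hd⟩ := hp
  obtain ⟨c, rfl⟩ := h
  refine ⟨decompose 𝒜 c (k - d), ?_⟩
  rw [← coe_decompose_mul_add_of_left_mem 𝒜 hd, add_sub_cancel]

theorem isHomogA_mul {x y : R} (hx : IsHomogA 𝒜 x) (hy : IsHomogA 𝒜 y) :
    IsHomogA 𝒜 (x * y) := by
  obtain ⟨i, hi⟩ := hx
  obtain ⟨j, hj⟩ := hy
  exact ⟨i + j, SetLike.mul_mem_graded hi hj⟩

theorem isHomogA_one : IsHomogA 𝒜 (1 : R) := ⟨0, SetLike.one_mem_graded 𝒜⟩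

theorem isHomogA_multiset_prod {s : Multiset R} (hs : ∀ g ∈ s, IsHomogA 𝒜 g) :
    IsHomogA 𝒜 s.prod :=
  Multiset.prod_induction _ s (fun _ _ => isHomogA_mul 𝒜) (isHomogA_one 𝒜) hs

variable [IsDomain R]

theorem mem_sub_of_mul_mem {p c : R} {i j : K} (hp : p ∈ 𝒜 i) (hp0 : p ≠ 0)
    (h : p * c ∈ 𝒜 j) : c ∈ 𝒜 (j - i) := by
  refine mem_of_decompose_eq_zero 𝒜 fun k hk => ?_
  have h1 := coe_decompose_mul_add_of_left_mem 𝒜 (j := k) (b := c) hp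
  rw [decompose_of_mem_ne 𝒜 h (by rintro rfl; exact hk (by abel))] at h1
  exact (mul_eq_zero.mp h1.symm).resolve_left hp0

theorem isHomogA_of_mul {p c : R} (hp : IsHomogA 𝒜 p) (hp0 : p ≠ 0)
    (h : IsHomogA 𝒜 (p * c)) : IsHomogA 𝒜 c := by
  obtain ⟨i, hi⟩ := hp
  obtain ⟨j, hj⟩ := h
  exact ⟨_, mem_sub_of_mul_mem 𝒜 hi hp0 hj⟩

variable {𝒜}

omit [IsDomain R] in
theorem IsGradedPrimeA.exists_dvd_of_dvd_prod {p : R} (hp : IsGradedPrimeA 𝒜 p)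
    {s : Multiset R} (hs : ∀ g ∈ s, IsHomogA 𝒜 g) (h : p ∣ s.prod) : ∃ q ∈ s, p ∣ q := by
  induction s using Multiset.induction_on with
  | empty => exact absurd (isUnit_of_dvd_one (by simpa using h)) hp.2.2.1
  | cons a s ih =>
    rw [Multiset.prod_cons] at h
    have hs' : ∀ g ∈ s, IsHomogA 𝒜 g := fun g hg => hs g (Multiset.mem_cons_of_mem hg)
    rcases hp.2.2.2 _ _ (hs a (Multiset.mem_cons_self a s)) (isHomogA_multiset_prod 𝒜 hs') h
      with h | h
    · exact ⟨a, Multiset.mem_cons_self a s, h⟩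
    · obtain ⟨q, hq, hpq⟩ := ih hs' h
      exact ⟨q, Multiset.mem_cons_of_mem hq, hpq⟩

theorem IsGradedPrimeA.exists_eq_mul_unit {p q : R} (hp : IsGradedPrimeA 𝒜 p)
    (hq : IsGradedPrimeA 𝒜 q) (h : p ∣ q) : ∃ e, IsUnit e ∧ q = p * e := by
  obtain ⟨e, rfl⟩ := h
  have he : IsHomogA 𝒜 e := isHomogA_of_mul 𝒜 hp.1 hp.2.1 hq.1
  refine ⟨e, ?_, rfl⟩
  rcases hq.2.2.2 p e hp.1 he dvd_rfl with ⟨t, ht⟩ | ⟨t, ht⟩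
  · have : p * (e * t) = p * 1 := by rw [mul_one, ← mul_assoc]; exact ht.symm
    exact IsUnit.of_mul_eq_one t (mul_left_cancel₀ hp.2.1 this)
  · have he0 : e ≠ 0 := right_ne_zero_of_mul hq.2.1
    have : e * (p * t) = e * 1 := by
      rw [mul_one]; calc
        e * (p * t) = p * e * t := by ring
        _ = e := ht.symm
    exact absurd (IsUnit.of_mul_eq_one t (mul_left_cancel₀ he0 this)) hp.2.2.1

/-- A graded prime can be cancelled from a product of graded primes and a unit. -/
theorem IsGradedPrimeA.cancel {p c u : R} (hp : IsGradedPrimeA 𝒜 p) (hu : IsUnit u)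
    {s : Multiset R} (hs : ∀ g ∈ s, IsGradedPrimeA 𝒜 g) (h : p * c = u * s.prod) :
    ∃ u' : R, ∃ s' : Multiset R, IsUnit u' ∧ (∀ g ∈ s', IsGradedPrimeA 𝒜 g) ∧
      c = u' * s'.prod ∧ s'.card < s.card := by
  have hdvd : p ∣ s.prod := (hu.dvd_mul_left).mp ⟨c, h.symm⟩
  obtain ⟨q, hq, hpq⟩ := hp.exists_dvd_of_dvd_prod (fun g hg => (hs g hg).1) hdvd
  obtain ⟨e, he, rfl⟩ := hp.exists_eq_mul_unit (hs q hq) hpq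
  obtain ⟨s', rfl⟩ := Multiset.exists_cons_of_mem hq
  refine ⟨u * e, s', hu.mul he, fun g hg => hs g (Multiset.mem_cons_of_mem hg), ?_, by simp⟩
  refine mul_left_cancel₀ hp.2.1 ?_
  rw [h, Multiset.prod_cons]
  ring

/-- `f` is a unit times a product of graded primes. -/
def HasGradedPrimeFactorization (𝒜 : K → AddSubgroup R) (f : R) : Prop :=
  ∃ u : R, ∃ s : Multiset R, IsUnit u ∧ (∀ g ∈ s, IsGradedPrimeA 𝒜 g) ∧ f = u * s.prod

omit [DecidableEq K] [GradedRing 𝒜] [IsDomain R] in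
theorem HasGradedPrimeFactorization.of_isUnit {u : R} (hu : IsUnit u) :
    HasGradedPrimeFactorization 𝒜 u :=
  ⟨u, 0, hu, by simp, by simp⟩

omit [DecidableEq K] [GradedRing 𝒜] [IsDomain R] in
theorem HasGradedPrimeFactorization.multiset_prod {s : Multiset R}
    (hs : ∀ g ∈ s, IsGradedPrimeA 𝒜 g) : HasGradedPrimeFactorization 𝒜 s.prod :=
  ⟨1, s, isUnit_one, hs, by simp⟩

omit [DecidableEq K] [GradedRing 𝒜] [IsDomain R] in
theorem IsGradedPrimeA.hasGradedPrimeFactorization {p : R} (hp : IsGradedPrimeA 𝒜 p) :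
    HasGradedPrimeFactorization 𝒜 p :=
  ⟨1, {p}, isUnit_one, by simpa using hp, by simp⟩

omit [DecidableEq K] [GradedRing 𝒜] [IsDomain R] in
theorem HasGradedPrimeFactorization.mul {x y : R} (hx : HasGradedPrimeFactorization 𝒜 x)
    (hy : HasGradedPrimeFactorization 𝒜 y) : HasGradedPrimeFactorization 𝒜 (x * y) := by
  obtain ⟨u, s, hu, hs, rfl⟩ := hx
  obtain ⟨v, t, hv, ht, rfl⟩ := hy
  refine ⟨u * v, s + t, hu.mul hv, fun g hg => ?_, by rw [Multiset.prod_add]; ring⟩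
  exact (Multiset.mem_add.mp hg).elim (hs g) (ht g)

theorem HasGradedPrimeFactorization.of_mul_left {t : Multiset R} {c : R}
    (ht : ∀ g ∈ t, IsGradedPrimeA 𝒜 g) (h : HasGradedPrimeFactorization 𝒜 (t.prod * c)) :
    HasGradedPrimeFactorization 𝒜 c := by
  induction t using Multiset.induction_on with
  | empty => simpa using h
  | cons p t ih =>
    refine ih (fun g hg => ht g (Multiset.mem_cons_of_mem hg)) ?_
    obtain ⟨u, s, hu, hs, hc⟩ := h
    rw [Multiset.prod_cons, mul_assoc] at hc
    obtain ⟨u', s', hu', hs', h', -⟩ := (ht p (Multiset.mem_cons_self p t)).cancel hu hs hc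
    exact ⟨u', s', hu', hs', h'⟩

theorem HasGradedPrimeFactorization.exists_eq_prod {f : R}
    (h : HasGradedPrimeFactorization 𝒜 f) (hf : IsHomogA 𝒜 f) (hfu : ¬IsUnit f) :
    ∃ s : Multiset R, (∀ g ∈ s, IsGradedPrimeA 𝒜 g) ∧ f = s.prod := by
  obtain ⟨u, s, hu, hs, rfl⟩ := h
  have hu' : IsHomogA 𝒜 u := by
    refine isHomogA_of_mul 𝒜 (isHomogA_multiset_prod 𝒜 fun g hg => (hs g hg).1) ?_
      (by rwa [mul_comm])
    exact Multiset.prod_ne_zero fun h0 => (hs 0 h0).2.1 rfl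
  rcases s.empty_or_exists_mem with rfl | ⟨a, ha⟩
  · exact absurd (by simpa using hu) hfu
  obtain ⟨t, rfl⟩ := Multiset.exists_cons_of_mem ha
  refine ⟨(u * a) ::ₘ t, ?_, by simp [mul_assoc]⟩
  intro g hg
  rcases Multiset.mem_cons.mp hg with rfl | hg
  · obtain ⟨h1, h2, h3, h4⟩ := hs a ha
    refine ⟨isHomogA_mul 𝒜 hu' h1, mul_ne_zero hu.ne_zero h2,
      fun h => h3 (isUnit_of_mul_isUnit_right h), fun x y hx hy hxy => ?_⟩
    rw [hu.mul_left_dvd] at hxy ⊢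
    rw [hu.mul_left_dvd]
    exact h4 x y hx hy hxy
  · exact hs g (Multiset.mem_cons_of_mem hg)

end GradedDomain

section Coarsen

variable {K K' R : Type} [AddCommGroup K] [AddCommGroup K'] [CommRing R]
  (φ : K →+ K') (𝒜 : K → AddSubgroup R)

theorem le_coarsenGrading (k : K) : 𝒜 k ≤ coarsenGrading φ 𝒜 (φ k) :=
  le_iSup₂_of_le (f := fun k' (_ : k' ∈ φ ⁻¹' {φ k}) => 𝒜 k') k rfl le_rfl

theorem coarsenGrading_induction {w : K'} {motive : R → Prop} (zero : motive 0)
    (mem : ∀ k, φ k = w → ∀ x ∈ 𝒜 k, motive x)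
    (add : ∀ x y, motive x → motive y → motive (x + y)) {x : R}
    (hx : x ∈ coarsenGrading φ 𝒜 w) : motive x := by
  refine AddSubgroup.iSup_induction _ (C := motive) hx (fun k x hx => ?_) zero add
  refine AddSubgroup.iSup_induction _ (C := motive) hx (fun h x hx => ?_) zero add
  exact mem k h x hx

variable [DecidableEq K] [DecidableEq K'] [GradedRing 𝒜]

/-- The decomposition map of the coarsened grading. -/
noncomputable def coarsenDecompose : R →+ ⨁ w, coarsenGrading φ 𝒜 w :=
  (toAddMonoid fun k => (of (fun w => coarsenGrading φ 𝒜 w) (φ k)).comp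
    (AddSubgroup.inclusion (le_coarsenGrading φ 𝒜 k))).comp (decomposeAddEquiv 𝒜).toAddMonoidHom

theorem coarsenDecompose_of_mem {x : R} {k : K} (hx : x ∈ 𝒜 k) :
    coarsenDecompose φ 𝒜 x =
      of (fun w => coarsenGrading φ 𝒜 w) (φ k) ⟨x, le_coarsenGrading φ 𝒜 k hx⟩ := by
  simp [coarsenDecompose, decompose_of_mem 𝒜 hx]
  rfl

theorem coarsenDecompose_of_mem_coarsenGrading {x : R} {w : K'}
    (hx : x ∈ coarsenGrading φ 𝒜 w) :
    coarsenDecompose φ 𝒜 x = of (fun w => coarsenGrading φ 𝒜 w) w ⟨x, hx⟩ := by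
  suffices ∃ hx : x ∈ coarsenGrading φ 𝒜 w,
    coarsenDecompose φ 𝒜 x = of (fun w => coarsenGrading φ 𝒜 w) w ⟨x, hx⟩ from this.2
  refine coarsenGrading_induction φ 𝒜 (w := w) (motive := fun x =>
    ∃ hx : x ∈ coarsenGrading φ 𝒜 w,
      coarsenDecompose φ 𝒜 x = of (fun w => coarsenGrading φ 𝒜 w) w ⟨x, hx⟩)
    ⟨zero_mem _, ?_⟩ ?_ ?_ hx
  · rw [map_zero]
    exact (map_zero (of (fun w => coarsenGrading φ 𝒜 w) w)).symm
  · rintro k rfl x hx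
    exact ⟨le_coarsenGrading φ 𝒜 k hx, coarsenDecompose_of_mem φ 𝒜 hx⟩
  · rintro x y ⟨hx, hx'⟩ ⟨hy, hy'⟩
    refine ⟨add_mem hx hy, ?_⟩
    rw [map_add, hx', hy', ← map_add]
    rfl

noncomputable instance coarsenGrading.gradedRing : GradedRing (coarsenGrading φ 𝒜) where
  one_mem := by
    rw [← map_zero φ]
    exact le_coarsenGrading φ 𝒜 0 (SetLike.one_mem_graded 𝒜)
  mul_mem := by
    intro i j x y hx hy
    refine coarsenGrading_induction φ 𝒜 (motive := fun x => x * y ∈ coarsenGrading φ 𝒜 (i + j))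
      (by simp) (fun k hk x hx => ?_)
      (fun x x' h h' => by rw [add_mul]; exact add_mem h h') hx
    refine coarsenGrading_induction φ 𝒜 (motive := fun y => x * y ∈ coarsenGrading φ 𝒜 (i + j))
      (by simp) (fun l hl y hy => ?_)
      (fun x x' h h' => by rw [mul_add]; exact add_mem h h') hy
    rw [← hk, ← hl, ← map_add]
    exact le_coarsenGrading φ 𝒜 _ (SetLike.mul_mem_graded hx hy)
  toDecomposition := by
    refine Decomposition.ofAddHom _ (coarsenDecompose φ 𝒜) ?_ ?_
    · ext x
      induction x using Decomposition.inductionOn 𝒜 with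
      | zero => simp
      | homogeneous m => simp [coarsenDecompose_of_mem φ 𝒜 m.2]
      | add x y hx hy => rw [map_add, hx, hy, map_add]
    · ext w ⟨y, hy⟩ : 2
      simpa using coarsenDecompose_of_mem_coarsenGrading φ 𝒜 hy

variable {φ 𝒜}

omit [DecidableEq K] [DecidableEq K'] [GradedRing 𝒜] in
theorem IsHomogA.coarsen {x : R} (h : IsHomogA 𝒜 x) : IsHomogA (coarsenGrading φ 𝒜) x := by
  obtain ⟨k, hk⟩ := h
  exact ⟨φ k, le_coarsenGrading φ 𝒜 k hk⟩

theorem map_eq_of_decompose_ne_zero {x : R} {w : K'} (hx : x ∈ coarsenGrading φ 𝒜 w) {k : K}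
    (hk : (decompose 𝒜 x k : R) ≠ 0) : φ k = w := by
  by_contra hne
  refine hk (coarsenGrading_induction φ 𝒜
    (motive := fun x => (decompose 𝒜 x k : R) = 0) ?_ ?_ ?_ hx)
  · simp
  · rintro l rfl x hx
    exact decompose_of_mem_ne 𝒜 hx (by rintro rfl; exact hne rfl)
  · intro x y hx hy
    simp [hx, hy]

/-- When the kernel of `φ` is torsion-free, graded primes stay prime after coarsening. -/
theorem IsGradedPrimeA.coarsen (hK : AddGroup.FG K)
    (hker : ∀ k : K, IsOfFinAddOrder k → φ k = 0 → k = 0) {p : R} (hp : IsGradedPrimeA 𝒜 p) :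
    IsGradedPrimeA (coarsenGrading φ 𝒜) p := by
  classical
  refine ⟨hp.1.coarsen, hp.2.1, hp.2.2.1, ?_⟩
  rintro g h ⟨v, hg⟩ ⟨w, hh⟩ hdvd
  by_contra! hcon
  let ψ := QuotientAddGroup.mk' (AddCommGroup.torsion K)
  have hψ : ∀ a b : K, ψ a = ψ b → φ a = φ b → a = b := by
    intro a b h1 h2
    rw [← sub_eq_zero]
    refine hker _ ?_ (by rw [map_sub, h2, sub_self])
    have : a - b ∈ AddCommGroup.torsion K := by
      rw [← QuotientAddGroup.eq_zero_iff]
      exact (map_sub ψ a b).trans (by rw [h1, sub_self])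
    exact this
  let A := {k ∈ (decompose 𝒜 g).support | ¬ p ∣ (decompose 𝒜 g k : R)}
  let B := {k ∈ (decompose 𝒜 h).support | ¬ p ∣ (decompose 𝒜 h k : R)}
  have memS : ∀ (x : R) k, ¬ p ∣ (decompose 𝒜 x k : R) → k ∈ (decompose 𝒜 x).support := by
    intro x k hk
    rw [DFinsupp.mem_support_iff]
    intro h0
    exact hk (by rw [h0]; simp)
  have hA : ∀ k, k ∈ A ↔ ¬ p ∣ (decompose 𝒜 g k : R) := fun k =>
    ⟨fun hk => (Finset.mem_filter.mp hk).2, fun hk => Finset.mem_filter.mpr ⟨memS g k hk, hk⟩⟩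
  have hB : ∀ k, k ∈ B ↔ ¬ p ∣ (decompose 𝒜 h k : R) := fun k =>
    ⟨fun hk => (Finset.mem_filter.mp hk).2, fun hk => Finset.mem_filter.mpr ⟨memS h k hk, hk⟩⟩
  have hφ : ∀ {x : R} {w : K'} (_ : x ∈ coarsenGrading φ 𝒜 w) {k : K},
      k ∈ (decompose 𝒜 x).support → φ k = w := fun hx k hk =>
    map_eq_of_decompose_ne_zero hx fun h0 => DFinsupp.mem_support_iff.mp hk (Subtype.ext h0)
  have hAne : A.Nonempty := by
    by_contra hne
    rw [Finset.not_nonempty_iff_eq_empty] at hne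
    refine hcon.1 (dvd_of_forall_dvd_decompose 𝒜 fun k => ?_)
    by_contra hk
    exact absurd ((hA k).mpr hk) (by simp [hne])
  have hBne : B.Nonempty := by
    by_contra hne
    rw [Finset.not_nonempty_iff_eq_empty] at hne
    refine hcon.2 (dvd_of_forall_dvd_decompose 𝒜 fun k => ?_)
    by_contra hk
    exact absurd ((hB k).mpr hk) (by simp [hne])
  have : AddGroup.FG (K ⧸ AddCommGroup.torsion K) := QuotientAddGroup.fg _
  obtain ⟨_, ha, _, hb, huniq⟩ := UniqueSums.uniqueAdd_of_nonempty
    (hAne.image ψ) (hBne.image ψ)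
  obtain ⟨a, haA, rfl⟩ := Finset.mem_image.mp ha
  obtain ⟨b, hbB, rfl⟩ := Finset.mem_image.mp hb
  have h1 := dvd_decompose_of_dvd 𝒜 hp.1 hdvd (a + b)
  rw [decompose_mul, coe_mul_apply, ← Finset.sum_erase_add (a := (a, b))] at h1
  · rw [dvd_add_right] at h1
    · rcases hp.2.2.2 _ _ ⟨a, (decompose 𝒜 g a).2⟩ ⟨b, (decompose 𝒜 h b).2⟩ h1 with h1 | h1
      · exact (hA a).mp haA h1
      · exact (hB b).mp hbB h1
    · refine Finset.dvd_sum fun ij hij => ?_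
      rw [Finset.mem_erase, Finset.mem_filter, Finset.mem_product] at hij
      obtain ⟨hne, ⟨hi, hj⟩, hsum⟩ := hij
      by_contra hnd
      have hiA : ij.1 ∈ A := (hA _).mpr fun h => hnd (h.mul_right _)
      have hjB : ij.2 ∈ B := (hB _).mpr fun h => hnd (h.mul_left _)
      obtain ⟨e1, e2⟩ := huniq (Finset.mem_image_of_mem ψ hiA) (Finset.mem_image_of_mem ψ hjB)
        (by rw [← map_add, hsum, map_add])
      refine hne (Prod.ext (hψ _ _ e1 ?_) (hψ _ _ e2 ?_))
      · rw [hφ hg hi, hφ hg (Finset.mem_filter.mp haA).1]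
      · rw [hφ hh hj, hφ hh (Finset.mem_filter.mp hbB).1]
  · rw [Finset.mem_filter, Finset.mem_product]
    exact ⟨⟨(Finset.mem_filter.mp haA).1, (Finset.mem_filter.mp hbB).1⟩, rfl⟩

end Coarsen

section Factor

variable {K K' R : Type} [AddCommGroup K] [AddCommGroup K'] [CommRing R] [IsDomain R]
  [DecidableEq K] [DecidableEq K'] {φ : K →+ K'} {𝒜 : K → AddSubgroup R} [GradedRing 𝒜]

omit [IsDomain R] [DecidableEq K] [GradedRing 𝒜] in
theorem FactoriallyGradedA.hasGradedPrimeFactorization (hfac : FactoriallyGradedA 𝒜) {f : R}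
    (hf : IsHomogA 𝒜 f) (hf0 : f ≠ 0) : HasGradedPrimeFactorization 𝒜 f := by
  by_cases hu : IsUnit f
  · exact .of_isUnit hu
  · obtain ⟨s, hs, rfl⟩ := hfac f hf hf0 hu
    exact .multiset_prod hs

/-- Split off all graded prime divisors of the finer grading from an element which is
homogeneous for the coarser one. -/
theorem FactoriallyGradedA.exists_eq_mul_not_dvd (hfac : FactoriallyGradedA 𝒜) {f : R}
    {w : K'} (hf : f ∈ coarsenGrading φ 𝒜 w) (hf0 : f ≠ 0) :
    ∃ k, ∃ s ∈ 𝒜 k, ∃ f' ∈ coarsenGrading φ 𝒜 (w - φ k), s ≠ 0 ∧ f = s * f' ∧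
      ∀ p, IsGradedPrimeA 𝒜 p → ¬ p ∣ f' := by
  obtain ⟨k, hk⟩ := exists_decompose_ne_zero 𝒜 hf0
  obtain ⟨u, m, hu, hm, h⟩ := hfac.hasGradedPrimeFactorization ⟨k, (decompose 𝒜 f k).2⟩ hk
  induction hn : m.card using Nat.strong_induction_on generalizing f w k u m with
  | _ n ih =>
    by_cases hex : ∃ p, IsGradedPrimeA 𝒜 p ∧ p ∣ f
    · obtain ⟨p, hp, c, rfl⟩ := hex
      obtain ⟨i, hi⟩ := hp.1
      have hc := mem_sub_of_mul_mem _ (le_coarsenGrading φ 𝒜 i hi) hp.2.1 hf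
      have hcomp := coe_decompose_mul_add_of_left_mem 𝒜 (j := k - i) (b := c) hi
      rw [add_sub_cancel] at hcomp
      obtain ⟨u', m', hu', hm', h', hlt⟩ := hp.cancel hu hm (hcomp.symm.trans h)
      rw [hcomp] at hk
      obtain ⟨l, s, hs, f', hf', hs0, rfl, hdvd⟩ := ih _ (hn ▸ hlt) hc
        (right_ne_zero_of_mul hf0) (k - i) (right_ne_zero_of_mul hk) u' m' hu' hm' h' rfl
      refine ⟨i + l, p * s, SetLike.mul_mem_graded hi hs, f', ?_, mul_ne_zero hp.2.1 hs0,
        (mul_assoc _ _ _).symm, hdvd⟩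
      rwa [map_add, ← sub_sub]
    · push Not at hex
      exact ⟨0, 1, SetLike.one_mem_graded 𝒜, f, by simpa using hf, one_ne_zero,
        (one_mul f).symm, hex⟩

theorem FactoriallyGradedA.dvd_of_dvd_mul (hfac : FactoriallyGradedA 𝒜) (hK : AddGroup.FG K)
    (hker : ∀ k : K, IsOfFinAddOrder k → φ k = 0 → k = 0) {t q c : R} (ht : IsHomogA 𝒜 t)
    (ht0 : t ≠ 0) (hq : IsHomogA (coarsenGrading φ 𝒜) q)
    (hqp : ∀ p, IsGradedPrimeA 𝒜 p → ¬ p ∣ q) (hc : IsHomogA (coarsenGrading φ 𝒜) c)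
    (h : t ∣ q * c) : t ∣ c := by
  obtain ⟨u, s, hu, hs, rfl⟩ := hfac.hasGradedPrimeFactorization ht ht0
  rw [hu.mul_left_dvd] at h ⊢
  clear ht ht0
  induction s using Multiset.induction_on generalizing c with
  | empty => simp
  | cons p s ih =>
    have hp := hs p (Multiset.mem_cons_self p s)
    have hp' := hp.coarsen (φ := φ) hK hker
    rw [Multiset.prod_cons] at h ⊢
    rcases hp'.2.2.2 q c hq hc ((dvd_mul_right _ _).trans h) with h1 | ⟨d, rfl⟩
    · exact absurd h1 (hqp p hp)
    · rw [mul_left_comm] at h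
      exact mul_dvd_mul_left p (ih (isHomogA_of_mul _ hp'.1 hp'.2.1 hc)
        (fun g hg => hs g (Multiset.mem_cons_of_mem hg)) ((mul_dvd_mul_iff_left hp.2.1).mp h))

theorem FactoriallyGradedA.exists_eq_mul_unit_of_mul (hfac : FactoriallyGradedA 𝒜)
    (hK : AddGroup.FG K) (hker : ∀ k : K, IsOfFinAddOrder k → φ k = 0 → k = 0) {a b : R}
    (ha : IsHomogA (coarsenGrading φ 𝒜) a) (hab : IsHomogA 𝒜 (a * b)) (hab0 : a * b ≠ 0) :
    ∃ s u, IsHomogA 𝒜 s ∧ s ≠ 0 ∧ IsUnit u ∧ a = s * u := by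
  have ha0 := left_ne_zero_of_mul hab0
  have hb : IsHomogA (coarsenGrading φ 𝒜) b := isHomogA_of_mul _ ha ha0 hab.coarsen
  obtain ⟨w, hw⟩ := ha
  obtain ⟨k, s, hs, a', ha', hs0, rfl, hdvd⟩ := hfac.exists_eq_mul_not_dvd hw ha0
  refine ⟨s, a', ⟨k, hs⟩, hs0, ?_, rfl⟩
  have hsh : IsHomogA 𝒜 s := ⟨k, hs⟩
  obtain ⟨d, hd⟩ := hfac.dvd_of_dvd_mul hK hker hab hab0 ⟨_, ha'⟩ hdvd (c := s * b)
    (isHomogA_mul _ hsh.coarsen hb) ⟨1, by ring⟩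
  refine IsUnit.of_mul_eq_one d (mul_left_cancel₀ hab0 ?_)
  calc s * a' * b * (a' * d) = a' * (s * a' * b * d) := by ring
    _ = a' * (s * b) := by rw [← hd]
    _ = _ := by ring

end Factor

section Fractions

variable {K K' R : Type} [AddCommGroup K] [AddCommGroup K'] [CommRing R] [IsDomain R]
  (φ : K →+ K') (𝒜 : K → AddSubgroup R) [SetLike.GradedMonoid 𝒜]
  (ℬ : K' → AddSubgroup R) [SetLike.GradedMonoid ℬ] [hle : Fact (∀ k, 𝒜 k ≤ ℬ (φ k))]

/-- The fractions of degree `v` whose numerator is homogeneous for `ℬ` and whose denominator is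
homogeneous for the finer grading `𝒜`. -/
def fracPart (v : K') : AddSubgroup (FractionRing R) where
  carrier := {x | ∃ k, ∃ s ∈ 𝒜 k, ∃ a ∈ ℬ (v + φ k), s ≠ 0 ∧
    x * algebraMap R (FractionRing R) s = algebraMap R (FractionRing R) a}
  zero_mem' := ⟨0, 1, SetLike.one_mem_graded 𝒜, 0, zero_mem _, one_ne_zero, by simp⟩
  neg_mem' := by
    rintro x ⟨k, s, hs, a, ha, hs0, h⟩
    exact ⟨k, s, hs, -a, neg_mem ha, hs0, by rw [neg_mul, h, map_neg]⟩
  add_mem' := by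
    rintro x y ⟨k, s, hs, a, ha, hs0, hx⟩ ⟨l, t, ht, b, hb, ht0, hy⟩
    refine ⟨k + l, s * t, SetLike.mul_mem_graded hs ht, a * t + b * s, add_mem ?_ ?_,
      mul_ne_zero hs0 ht0, ?_⟩
    · rw [map_add, ← add_assoc]
      exact SetLike.mul_mem_graded ha (hle.out l ht)
    · rw [map_add, add_comm (φ k), ← add_assoc]
      exact SetLike.mul_mem_graded hb (hle.out k hs)
    · rw [map_add, map_mul, map_mul, map_mul, ← hx, ← hy]
      ring

variable {φ 𝒜 ℬ}

theorem mem_fracPart {v : K'} {x : FractionRing R} : x ∈ fracPart φ 𝒜 ℬ v ↔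
    ∃ k, ∃ s ∈ 𝒜 k, ∃ a ∈ ℬ (v + φ k), s ≠ 0 ∧
      x * algebraMap R (FractionRing R) s = algebraMap R (FractionRing R) a := Iff.rfl

theorem mul_mem_fracPart {v w : K'} {x y : FractionRing R} (hx : x ∈ fracPart φ 𝒜 ℬ v)
    (hy : y ∈ fracPart φ 𝒜 ℬ w) : x * y ∈ fracPart φ 𝒜 ℬ (v + w) := by
  obtain ⟨k, s, hs, a, ha, hs0, hx⟩ := hx
  obtain ⟨l, t, ht, b, hb, ht0, hy⟩ := hy
  refine ⟨k + l, s * t, SetLike.mul_mem_graded hs ht, a * b, ?_, mul_ne_zero hs0 ht0, ?_⟩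
  · rw [map_add, add_add_add_comm]
    exact SetLike.mul_mem_graded ha hb
  · rw [map_mul, map_mul, ← hx, ← hy]
    ring

theorem algebraMap_mem_fracPart {v : K'} {a : R} (ha : a ∈ ℬ v) :
    algebraMap R (FractionRing R) a ∈ fracPart φ 𝒜 ℬ v :=
  ⟨0, 1, SetLike.one_mem_graded 𝒜, a, by simpa using ha, one_ne_zero, by simp⟩

theorem one_mem_fracPart : 1 ∈ fracPart φ 𝒜 ℬ 0 := by
  rw [← map_one (algebraMap R (FractionRing R))]
  exact algebraMap_mem_fracPart (SetLike.one_mem_graded ℬ)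

theorem inv_algebraMap_mem_fracPart {k : K} {s : R} (hs : s ∈ 𝒜 k) :
    (algebraMap R (FractionRing R) s)⁻¹ ∈ fracPart φ 𝒜 ℬ (-φ k) := by
  by_cases hs0 : s = 0
  · simp [hs0]
  · refine ⟨k, s, hs, 1, ?_, hs0, ?_⟩
    · rw [neg_add_cancel]
      exact SetLike.one_mem_graded ℬ
    · rw [map_one, inv_mul_cancel₀]
      simpa using hs0

variable (φ 𝒜 ℬ) in
/-- The ring of fractions of degree `0`. -/
def fracRing : Subring (FractionRing R) where
  __ := fracPart φ 𝒜 ℬ 0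
  one_mem' := one_mem_fracPart
  mul_mem' hx hy := by simpa using mul_mem_fracPart hx hy

theorem mem_fracRing {x : FractionRing R} : x ∈ fracRing φ 𝒜 ℬ ↔ x ∈ fracPart φ 𝒜 ℬ 0 :=
  Iff.rfl

instance fact_le_id : Fact (∀ k, 𝒜 k ≤ 𝒜 (AddMonoidHom.id K k)) := ⟨fun _ => le_rfl⟩

variable (𝒜) in
/-- The fractions of degree `k` of homogeneous elements. -/
abbrev homogFrac (k : K) : AddSubgroup (FractionRing R) := fracPart (AddMonoidHom.id K) 𝒜 𝒜 k

theorem homogFrac_le_fracPart (k : K) : homogFrac 𝒜 k ≤ fracPart φ 𝒜 ℬ (φ k) := by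
  rintro x ⟨l, s, hs, a, ha, hs0, hx⟩
  refine ⟨l, s, hs, a, ?_, hs0, hx⟩
  rw [← map_add]
  exact hle.out _ ha

omit hle [SetLike.GradedMonoid ℬ] in
theorem inv_mem_homogFrac {k : K} {x : FractionRing R} (hx : x ∈ homogFrac 𝒜 k) :
    x⁻¹ ∈ homogFrac 𝒜 (-k) := by
  by_cases hx0 : x = 0
  · simp [hx0]
  obtain ⟨l, s, hs, a, ha, hs0, hx⟩ := hx
  have ha0 : a ≠ 0 := by
    rintro rfl
    rw [map_zero, mul_eq_zero] at hx
    exact hx.elim hx0 (by simpa using hs0)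
  refine ⟨k + l, a, ha, s, ?_, ha0, ?_⟩
  · simpa using hs
  · rw [← hx, inv_mul_cancel_left₀ hx0]

variable (𝒜) in
/-- The field of fractions of degree `0` of homogeneous elements. -/
def homogFracField : Subfield (FractionRing R) where
  __ := fracRing (AddMonoidHom.id K) 𝒜 𝒜
  inv_mem' x hx := by
    have := inv_mem_homogFrac (𝒜 := 𝒜) (k := 0) hx
    rwa [neg_zero] at this

theorem mem_homogFracField {x : FractionRing R} :
    x ∈ homogFracField 𝒜 ↔ x ∈ homogFrac 𝒜 0 :=
  Iff.rfl

theorem pow_mem_homogFrac {k : K} {x : FractionRing R} (hx : x ∈ homogFrac 𝒜 k) (n : ℕ) :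
    x ^ n ∈ homogFrac 𝒜 (n • k) := by
  induction n with
  | zero => simpa using one_mem_fracPart
  | succ n ih =>
    rw [pow_succ, succ_nsmul]
    exact mul_mem_fracPart ih hx

theorem prod_mem_homogFrac {ι : Type*} (I : Finset ι) {k : ι → K} {x : ι → FractionRing R}
    (hx : ∀ i ∈ I, x i ∈ homogFrac 𝒜 (k i)) :
    ∏ i ∈ I, x i ∈ homogFrac 𝒜 (∑ i ∈ I, k i) := by
  classical
  induction I using Finset.induction_on with
  | empty => simpa using one_mem_fracPart
  | insert i I hi ih =>
    rw [Finset.prod_insert hi, Finset.sum_insert hi]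
    exact mul_mem_fracPart (hx i (Finset.mem_insert_self i I))
      (ih fun j hj => hx j (Finset.mem_insert_of_mem hj))

theorem exists_common_denom {ι : Type*} (I : Finset ι) {k : ι → K} {x : ι → FractionRing R}
    (hx : ∀ i ∈ I, x i ∈ homogFrac 𝒜 (k i)) :
    ∃ l, ∃ s ∈ 𝒜 l, s ≠ 0 ∧ ∀ i ∈ I, ∃ a ∈ 𝒜 (k i + l),
      x i * algebraMap R (FractionRing R) s = algebraMap R (FractionRing R) a := by
  classical
  induction I using Finset.induction_on with
  | empty => exact ⟨0, 1, SetLike.one_mem_graded 𝒜, one_ne_zero, by simp⟩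
  | insert i I hi ih =>
    obtain ⟨l, s, hs, hs0, h⟩ := ih fun j hj => hx j (Finset.mem_insert_of_mem hj)
    obtain ⟨l', t, ht, b, hb, ht0, hxi⟩ := hx i (Finset.mem_insert_self i I)
    refine ⟨l + l', s * t, SetLike.mul_mem_graded hs ht, mul_ne_zero hs0 ht0, fun j hj => ?_⟩
    rcases Finset.mem_insert.mp hj with rfl | hj
    · refine ⟨b * s, ?_, by rw [map_mul, map_mul, ← hxi]; ring⟩
      rw [add_comm l l', ← add_assoc]
      exact SetLike.mul_mem_graded hb hs
    · obtain ⟨a, ha, h⟩ := h j hj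
      refine ⟨a * t, ?_, by rw [map_mul, map_mul, ← h]; ring⟩
      rw [← add_assoc]
      exact SetLike.mul_mem_graded ha ht

end Fractions

section Independence

variable {K R : Type} [AddCommGroup K] [DecidableEq K] [CommRing R] [IsDomain R]
  {𝒜 : K → AddSubgroup R} [GradedRing 𝒜]

/-- Homogeneous fractions of pairwise distinct degrees are linearly independent. -/
theorem eq_zero_of_sum_homogFrac_eq_zero {ι : Type*} {I : Finset ι} {k : ι → K}
    (hk : Function.Injective k) {x : ι → FractionRing R}
    (hx : ∀ i ∈ I, x i ∈ homogFrac 𝒜 (k i)) (h : ∑ i ∈ I, x i = 0) : ∀ i ∈ I, x i = 0 := by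
  classical
  obtain ⟨l, s, hs, hs0, H⟩ := exists_common_denom I hx
  choose! a ha hxa using H
  have hsum : ∑ i ∈ I, a i = 0 := by
    refine IsFractionRing.injective R (FractionRing R) ?_
    rw [map_sum, map_zero, ← Finset.sum_congr rfl hxa, ← Finset.sum_mul, h, zero_mul]
  intro j hj
  have hcomp : ∑ i ∈ I, (decompose 𝒜 (a i) (k j + l) : R) = 0 := by
    have := congrArg (GradedRing.proj 𝒜 (k j + l)) hsum
    simpa [GradedRing.proj_apply, map_sum] using this
  rw [Finset.sum_eq_single_of_mem j hj, decompose_of_mem_same 𝒜 (ha j hj)] at hcomp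
  · have := hxa j hj
    rw [hcomp, map_zero, mul_eq_zero] at this
    exact this.resolve_right (by simpa using hs0)
  · intro i hi hij
    exact decompose_of_mem_ne 𝒜 (ha i hi) fun he => hij (hk (add_right_cancel he))

end Independence

section Laurent

variable {K K' R : Type} [AddCommGroup K] [AddCommGroup K'] [DecidableEq K] [DecidableEq K']
  [CommRing R] [IsDomain R] (φ : K →+ K') (𝒜 : K → AddSubgroup R) [GradedRing 𝒜]

instance fact_le_coarsenGrading : Fact (∀ k, 𝒜 k ≤ coarsenGrading φ 𝒜 (φ k)) :=
  ⟨le_coarsenGrading φ 𝒜⟩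

variable {φ 𝒜} {ι : Type*} [Fintype ι] {e : ι → K} {u : ι → FractionRing R}

theorem aeval_monomial_mem_homogFrac (hu : ∀ i, u i ∈ homogFrac 𝒜 (e i)) (n : ι →₀ ℕ)
    (c : homogFracField 𝒜) :
    MvPolynomial.aeval u (MvPolynomial.monomial n c) ∈ homogFrac 𝒜 (∑ i, n i • e i) := by
  rw [MvPolynomial.aeval_monomial, Finsupp.prod_fintype _ _ (by simp), ← zero_add (∑ i, _)]
  exact mul_mem_fracPart (mem_homogFracField.mp c.2)
    (prod_mem_homogFrac _ fun i _ => pow_mem_homogFrac (hu i) (n i))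

omit [DecidableEq K] [GradedRing 𝒜] [IsDomain R] [CommRing R] in
theorem sum_nsmul_injective (he : LinearIndependent ℤ e) :
    Function.Injective fun n : ι →₀ ℕ => ∑ i, n i • e i := by
  intro n m h
  have h0 : ∑ i, ((n i : ℤ) - m i) • e i = 0 := by
    simp only [sub_smul, natCast_zsmul, Finset.sum_sub_distrib]
    exact sub_eq_zero.mpr h
  ext i
  have := Fintype.linearIndependent_iff.mp he _ h0 i
  omega

theorem aeval_injective_of_linearIndependent (he : LinearIndependent ℤ e)
    (hu : ∀ i, u i ∈ homogFrac 𝒜 (e i)) (hu0 : ∀ i, u i ≠ 0) :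
    Function.Injective
      (MvPolynomial.aeval u : MvPolynomial ι (homogFracField 𝒜) →ₐ[_] FractionRing R) := by
  rw [injective_iff_map_eq_zero]
  intro p hp
  rw [p.as_sum, map_sum] at hp
  have := eq_zero_of_sum_homogFrac_eq_zero (sum_nsmul_injective he)
    (fun n _ => aeval_monomial_mem_homogFrac hu n (p.coeff n)) hp
  rw [← MvPolynomial.support_eq_empty, Finset.eq_empty_iff_forall_notMem]
  intro n hn
  have h0 := this n hn
  rw [MvPolynomial.aeval_monomial, mul_eq_zero] at h0
  rcases h0 with h0 | h0
  · exact MvPolynomial.mem_support_iff.mp hn (by simpa using h0)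
  · rw [Finsupp.prod, Finset.prod_eq_zero_iff] at h0
    obtain ⟨i, -, hi⟩ := h0
    exact hu0 i (eq_zero_of_pow_eq_zero hi)

omit [Fintype ι] in
theorem aeval_mem_fracRing (heφ : ∀ i, φ (e i) = 0) (hu : ∀ i, u i ∈ homogFrac 𝒜 (e i))
    (p : MvPolynomial ι (homogFracField 𝒜)) :
    MvPolynomial.aeval u p ∈ fracRing φ 𝒜 (coarsenGrading φ 𝒜) := by
  have hmem : ∀ k, φ k = 0 → ∀ x ∈ homogFrac 𝒜 k, x ∈ fracRing φ 𝒜 (coarsenGrading φ 𝒜) := by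
    intro k hk x hx
    have := homogFrac_le_fracPart (φ := φ) (ℬ := coarsenGrading φ 𝒜) k hx
    rwa [hk] at this
  induction p using MvPolynomial.induction_on with
  | C c =>
    rw [MvPolynomial.aeval_C]
    exact hmem 0 (map_zero φ) _ c.2
  | add p q hp hq => rw [map_add]; exact add_mem hp hq
  | mul_X p i hp =>
    rw [map_mul, MvPolynomial.aeval_X]
    exact mul_mem hp (hmem _ (heφ i) _ (hu i))

theorem exists_mul_aeval_eq (hu : ∀ i, u i ∈ homogFrac 𝒜 (e i)) (hu0 : ∀ i, u i ≠ 0)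
    (hspan : ∀ k, φ k = 0 → (∃ x ∈ homogFrac 𝒜 k, x ≠ 0) → ∃ n : ι → ℤ, ∑ i, n i • e i = k)
    {x : FractionRing R} (hx : x ∈ fracRing φ 𝒜 (coarsenGrading φ 𝒜)) :
    ∃ (n : ι →₀ ℕ) (p : MvPolynomial ι (homogFracField 𝒜)),
      x * MvPolynomial.aeval u (MvPolynomial.monomial n (1 : homogFracField 𝒜)) =
        MvPolynomial.aeval u p := by
  obtain ⟨k, s, hs, a, ha, hs0, hxa⟩ := hx
  have hs0' : algebraMap R (FractionRing R) s ≠ 0 := by simpa using hs0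
  obtain rfl : x = algebraMap R (FractionRing R) a * (algebraMap R (FractionRing R) s)⁻¹ :=
    (eq_mul_inv_iff_mul_eq₀ hs0').mpr hxa
  clear hxa
  rw [zero_add] at ha
  refine coarsenGrading_induction φ 𝒜 (motive := fun a => ∃ (n : ι →₀ ℕ)
    (p : MvPolynomial ι (homogFracField 𝒜)), algebraMap R (FractionRing R) a *
      (algebraMap R (FractionRing R) s)⁻¹ * MvPolynomial.aeval u
        (MvPolynomial.monomial n (1 : homogFracField 𝒜)) = MvPolynomial.aeval u p) ?_ ?_ ?_ ha
  · exact ⟨0, 0, by simp⟩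
  · intro j hj b hb
    by_cases hb0 : b = 0
    · exact ⟨0, 0, by simp [hb0]⟩
    have hmem : algebraMap R (FractionRing R) b * (algebraMap R (FractionRing R) s)⁻¹ ∈
        homogFrac 𝒜 (j - k) := by
      rw [sub_eq_add_neg]
      exact mul_mem_fracPart (algebraMap_mem_fracPart hb) (inv_algebraMap_mem_fracPart hs)
    obtain ⟨n, hn⟩ := hspan (j - k) (by rw [map_sub, hj, sub_self])
      ⟨_, hmem, mul_ne_zero (by simpa using hb0) (inv_ne_zero hs0')⟩
    let np : ι →₀ ℕ := Finsupp.equivFunOnFinite.symm fun i => (n i).toNat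
    let nm : ι →₀ ℕ := Finsupp.equivFunOnFinite.symm fun i => (-n i).toNat
    have hdeg : (j - k) + ∑ i, nm i • e i + -∑ i, np i • e i = 0 := by
      rw [← hn, ← sub_eq_add_neg, ← Finset.sum_add_distrib, ← Finset.sum_sub_distrib]
      refine Finset.sum_eq_zero fun i _ => ?_
      rw [← natCast_zsmul, ← natCast_zsmul, ← add_smul, ← sub_smul]
      convert zero_smul ℤ (e i)
      simp only [np, nm, Finsupp.equivFunOnFinite_symm_apply_apply]
      omega
    have hc := mul_mem_fracPart (mul_mem_fracPart hmem (aeval_monomial_mem_homogFrac hu nm 1))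
      (inv_mem_homogFrac (aeval_monomial_mem_homogFrac hu np 1))
    rw [hdeg] at hc
    refine ⟨nm, MvPolynomial.monomial np ⟨_, mem_homogFracField.mpr hc⟩, ?_⟩
    refine Eq.trans ?_ (MvPolynomial.aeval_monomial ..).symm
    have hne : np.prod (fun i m => u i ^ m) ≠ 0 := by
      rw [Finsupp.prod_fintype _ _ (by simp)]
      exact Finset.prod_ne_zero_iff.mpr fun i _ => pow_ne_zero _ (hu0 i)
    have hone : MvPolynomial.aeval u (MvPolynomial.monomial np (1 : homogFracField 𝒜)) =
        np.prod fun i m => u i ^ m := by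
      rw [MvPolynomial.aeval_monomial, map_one, one_mul]
    refine ((inv_mul_cancel_right₀ hne _).symm.trans ?_)
    rw [← hone]
    rfl
  · rintro b c ⟨n, p, hp⟩ ⟨m, q, hq⟩
    refine ⟨n + m, p * MvPolynomial.monomial m 1 + q * MvPolynomial.monomial n 1, ?_⟩
    have : MvPolynomial.monomial (n + m) (1 : homogFracField 𝒜) =
      MvPolynomial.monomial n 1 * MvPolynomial.monomial m 1 := by
      rw [MvPolynomial.monomial_mul, one_mul]
    rw [this, map_add, map_add, map_mul, map_mul, map_mul, ← hp, ← hq]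
    ring

/-- The degree zero part of the localization at all homogeneous elements is a localization of a
polynomial ring over a field, hence factorial. -/
theorem uniqueFactorizationMonoid_fracRing_of_linearIndependent (he : LinearIndependent ℤ e)
    (heφ : ∀ i, φ (e i) = 0) (hu : ∀ i, u i ∈ homogFrac 𝒜 (e i)) (hu0 : ∀ i, u i ≠ 0)
    (hspan : ∀ k, φ k = 0 → (∃ x ∈ homogFrac 𝒜 k, x ≠ 0) → ∃ n : ι → ℤ, ∑ i, n i • e i = k) :
    UniqueFactorizationMonoid (fracRing φ 𝒜 (coarsenGrading φ 𝒜)) := by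
  let ev : MvPolynomial ι (homogFracField 𝒜) →+* fracRing φ 𝒜 (coarsenGrading φ 𝒜) :=
    (MvPolynomial.aeval u : MvPolynomial ι (homogFracField 𝒜) →ₐ[_] FractionRing R).toRingHom
      |>.codRestrict _ (aeval_mem_fracRing heφ hu)
  let : Algebra (MvPolynomial ι (homogFracField 𝒜)) (fracRing φ 𝒜 (coarsenGrading φ 𝒜)) :=
    ev.toAlgebra
  let T : Submonoid (MvPolynomial ι (homogFracField 𝒜)) :=
    { carrier := {p | ∃ n, p = MvPolynomial.monomial n 1}
      one_mem' := ⟨0, rfl⟩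
      mul_mem' := by
        rintro _ _ ⟨n, rfl⟩ ⟨m, rfl⟩
        exact ⟨n + m, by rw [MvPolynomial.monomial_mul, one_mul]⟩ }
  have hinj := aeval_injective_of_linearIndependent he hu hu0
  have : IsLocalization T (fracRing φ 𝒜 (coarsenGrading φ 𝒜)) := by
    rw [isLocalization_iff]
    refine ⟨?_, ?_, ?_⟩
    · rintro ⟨_, n, rfl⟩
      have hmem := aeval_monomial_mem_homogFrac hu n (1 : homogFracField 𝒜)
      have hne : MvPolynomial.aeval u (MvPolynomial.monomial n (1 : homogFracField 𝒜)) ≠ 0 := by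
        rw [Ne, map_eq_zero_iff _ hinj]
        simp
      have hinv := homogFrac_le_fracPart (φ := φ) (ℬ := coarsenGrading φ 𝒜) _
        (inv_mem_homogFrac hmem)
      simp only [map_neg, map_sum, map_nsmul, heφ, smul_zero, Finset.sum_const_zero,
        neg_zero] at hinv
      exact IsUnit.of_mul_eq_one (⟨_, hinv⟩ : fracRing φ 𝒜 (coarsenGrading φ 𝒜))
        (Subtype.ext (mul_inv_cancel₀ hne))
    · rintro ⟨x, hx⟩
      obtain ⟨n, p, h⟩ := exists_mul_aeval_eq hu hu0 hspan hx
      exact ⟨(p, ⟨_, n, rfl⟩), Subtype.ext h⟩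
    · intro p q h
      exact ⟨1, by rw [hinj (congrArg Subtype.val h)]⟩
  exact UniqueFactorizationMonoid.of_isLocalization T _

variable (φ 𝒜) in
theorem uniqueFactorizationMonoid_fracRing (hK : AddGroup.FG K)
    (hker : ∀ k : K, IsOfFinAddOrder k → φ k = 0 → k = 0) :
    UniqueFactorizationMonoid (fracRing φ 𝒜 (coarsenGrading φ 𝒜)) := by
  let F : AddSubgroup K :=
    { carrier := {k | φ k = 0 ∧ ∃ x ∈ homogFrac 𝒜 k, x ≠ 0}
      zero_mem' := ⟨map_zero φ, 1, one_mem_fracPart, one_ne_zero⟩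
      add_mem' := by
        rintro k l ⟨hk, x, hx, hx0⟩ ⟨hl, y, hy, hy0⟩
        exact ⟨by rw [map_add, hk, hl, add_zero], x * y, mul_mem_fracPart hx hy,
          mul_ne_zero hx0 hy0⟩
      neg_mem' := by
        rintro k ⟨hk, x, hx, hx0⟩
        exact ⟨by rw [map_neg, hk, neg_zero], x⁻¹, inv_mem_homogFrac hx, inv_ne_zero hx0⟩ }
  have : Module.Finite ℤ K := Module.Finite.iff_addGroup_fg.mpr hK
  have : Module.Finite ℤ F := Module.Finite.of_injective F.subtype.toIntLinearMap
    F.subtype_injective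
  have : IsAddTorsionFree F := by
    refine IsAddTorsionFree.of_not_isOfFinAddOrder ?_
    intro k hk0 hk
    exact hk0 (Subtype.ext (hker k (F.subtype.isOfFinAddOrder hk) k.2.1))
  have : Module.Free ℤ F := Module.free_of_finite_type_torsion_free'
  let b := Module.Free.chooseBasis ℤ F
  choose u hu hu0 using fun i => (b i).2.2
  refine uniqueFactorizationMonoid_fracRing_of_linearIndependent (e := fun i => (b i : K)) (u := u)
    ?_ (fun i => (b i).2.1) hu hu0 ?_
  · exact b.linearIndependent.map_injOn F.subtype.toIntLinearMap F.subtype_injective.injOn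
  · intro k hk hx
    refine ⟨fun i => b.repr ⟨k, hk, hx⟩ i, ?_⟩
    have := congrArg F.subtype (b.sum_repr ⟨k, hk, hx⟩)
    rw [map_sum] at this
    simp only [map_zsmul] at this
    exact this

end Laurent

section Main

variable {K K' R : Type} [AddCommGroup K] [AddCommGroup K'] [CommRing R] [IsDomain R]
  [DecidableEq K] [DecidableEq K'] {φ : K →+ K'} {𝒜 : K → AddSubgroup R} [GradedRing 𝒜]

omit [IsDomain R] in
theorem exists_mem_ne_zero_of_mem_coarsenGrading {f : R} {w : K'}
    (hf : f ∈ coarsenGrading φ 𝒜 w) (hf0 : f ≠ 0) : ∃ k, φ k = w ∧ ∃ s ∈ 𝒜 k, s ≠ 0 := by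
  obtain ⟨k, hk⟩ := exists_decompose_ne_zero 𝒜 hf0
  exact ⟨k, map_eq_of_decompose_ne_zero hf hk, _, (decompose 𝒜 f k).2, hk⟩

omit [IsDomain R] in
theorem FactoriallyGradedA.hasGradedPrimeFactorization_coarsen (hfac : FactoriallyGradedA 𝒜)
    (hK : AddGroup.FG K) (hker : ∀ k : K, IsOfFinAddOrder k → φ k = 0 → k = 0) {f : R}
    (hf : IsHomogA 𝒜 f) (hf0 : f ≠ 0) :
    HasGradedPrimeFactorization (coarsenGrading φ 𝒜) f := by
  obtain ⟨u, s, hu, hs, rfl⟩ := hfac.hasGradedPrimeFactorization hf hf0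
  exact ⟨u, s, hu, fun g hg => (hs g hg).coarsen hK hker, rfl⟩

/-- Numerators of primes in degree zero of the localization are graded prime once they are
coprime to all graded primes of the finer grading. -/
theorem FactoriallyGradedA.isGradedPrimeA_of_prime (hfac : FactoriallyGradedA 𝒜)
    (hK : AddGroup.FG K) (hker : ∀ k : K, IsOfFinAddOrder k → φ k = 0 → k = 0)
    {π : fracRing φ 𝒜 (coarsenGrading φ 𝒜)} (hπ : Prime π) {k l : K} {s t q : R}
    (hs : s ∈ 𝒜 k) (hs0 : s ≠ 0) (ht : t ∈ 𝒜 l) (ht0 : t ≠ 0)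
    (hq : q ∈ coarsenGrading φ 𝒜 (φ l - φ k)) (hqp : ∀ p, IsGradedPrimeA 𝒜 p → ¬ p ∣ q)
    (h : (π : FractionRing R) * algebraMap R _ t = algebraMap R _ (s * q)) :
    IsGradedPrimeA (coarsenGrading φ 𝒜) q := by
  have inj := IsFractionRing.injective R (FractionRing R)
  have ne : ∀ {r : R}, r ≠ 0 → algebraMap R (FractionRing R) r ≠ 0 := fun hr => by simpa using hr
  have hπ0 : (π : FractionRing R) ≠ 0 := fun h0 => hπ.ne_zero (Subtype.ext h0)
  have hq0 : q ≠ 0 := by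
    rintro rfl
    rw [mul_zero, map_zero] at h
    exact mul_ne_zero hπ0 (ne ht0) h
  have hπq : (π : FractionRing R) =
      algebraMap R _ s * algebraMap R _ q * (algebraMap R _ t)⁻¹ := by
    rw [eq_mul_inv_iff_mul_eq₀ (ne ht0), h, map_mul]
  have deg : ∀ {v : K'} {x : FractionRing R}, x ∈ fracPart φ 𝒜 (coarsenGrading φ 𝒜) v →
      v = 0 → x ∈ fracRing φ 𝒜 (coarsenGrading φ 𝒜) := by
    rintro _ x hx rfl
    exact hx
  refine ⟨⟨_, hq⟩, hq0, fun hqu => hπ.not_isUnit ?_, ?_⟩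
  · obtain ⟨r, hr⟩ := hqu.exists_right_inv
    have hrd := mem_sub_of_mul_mem _ hq hq0 (hr ▸ SetLike.one_mem_graded (coarsenGrading φ 𝒜))
    have hmem := mul_mem_fracPart (mul_mem_fracPart
      (algebraMap_mem_fracPart (φ := φ) (𝒜 := 𝒜) (le_coarsenGrading φ 𝒜 l ht))
      (algebraMap_mem_fracPart hrd)) (inv_algebraMap_mem_fracPart hs)
    refine IsUnit.of_mul_eq_one ⟨_, deg hmem (by abel)⟩ (Subtype.ext ?_)
    have hr' : algebraMap R (FractionRing R) q * algebraMap R (FractionRing R) r = 1 := by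
      rw [← map_mul, hr, map_one]
    change (π : FractionRing R) * _ = 1
    rw [hπq]
    have h1 := ne hs0
    have h2 := ne ht0
    field_simp
    exact hr'
  · have key : ∀ (g r : R) (hx : algebraMap R (FractionRing R) g * (algebraMap R _ r)⁻¹ ∈
        fracRing φ 𝒜 (coarsenGrading φ 𝒜)), IsHomogA 𝒜 r → r ≠ 0 → π ∣ ⟨_, hx⟩ → q ∣ g := by
      rintro g r hx hr hr0 ⟨⟨z, m, b, hb, a, ha, hb0, hz⟩, hdvd⟩
      have hdvd' : algebraMap R (FractionRing R) g * (algebraMap R _ r)⁻¹ = π * z :=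
        congrArg Subtype.val hdvd
      have heq : g * (t * b) = q * (s * a * r) := by
        refine inj ?_
        simp only [map_mul]
        rw [← hz]
        rw [hπq] at hdvd'
        have h1 := ne hr0
        have h2 := ne ht0
        field_simp at hdvd'
        linear_combination (algebraMap R (FractionRing R) b) * hdvd'
      have hsh : IsHomogA 𝒜 s := ⟨k, hs⟩
      obtain ⟨d, hd⟩ := hfac.dvd_of_dvd_mul hK hker (t := t * b) (q := q) (c := s * a * r)
        (isHomogA_mul 𝒜 ⟨l, ht⟩ ⟨m, hb⟩) (mul_ne_zero ht0 hb0) ⟨_, hq⟩ hqp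
        (isHomogA_mul _ (isHomogA_mul _ hsh.coarsen ⟨_, ha⟩) hr.coarsen)
        ⟨g, by rw [← heq, mul_comm]⟩
      refine ⟨d, mul_right_cancel₀ (mul_ne_zero ht0 hb0) ?_⟩
      rw [heq, hd]
      ring
    rintro g g' ⟨v, hg⟩ ⟨v', hg'⟩ ⟨c, hc⟩
    by_cases hg0 : g = 0
    · exact Or.inl (hg0 ▸ dvd_zero q)
    by_cases hg0' : g' = 0
    · exact Or.inr (hg0' ▸ dvd_zero q)
    have hcd := mem_sub_of_mul_mem _ hq hq0 (hc ▸ SetLike.mul_mem_graded hg hg')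
    obtain ⟨i, rfl, r, hr, hr0⟩ := exists_mem_ne_zero_of_mem_coarsenGrading hg hg0
    obtain ⟨i', rfl, r', hr', hr0'⟩ := exists_mem_ne_zero_of_mem_coarsenGrading hg' hg0'
    have hx := deg (mul_mem_fracPart (algebraMap_mem_fracPart (φ := φ) (𝒜 := 𝒜) hg)
      (inv_algebraMap_mem_fracPart hr)) (by abel)
    have hx' := deg (mul_mem_fracPart (algebraMap_mem_fracPart (φ := φ) (𝒜 := 𝒜) hg')
      (inv_algebraMap_mem_fracPart hr')) (by abel)
    have hy := deg (mul_mem_fracPart (mul_mem_fracPart (mul_mem_fracPart (mul_mem_fracPart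
      (algebraMap_mem_fracPart (φ := φ) (𝒜 := 𝒜) hcd)
      (algebraMap_mem_fracPart (le_coarsenGrading φ 𝒜 l ht))) (inv_algebraMap_mem_fracPart hs))
      (inv_algebraMap_mem_fracPart hr)) (inv_algebraMap_mem_fracPart hr')) (by abel)
    have hdvd : π ∣ (⟨_, hx⟩ * ⟨_, hx'⟩ : fracRing φ 𝒜 (coarsenGrading φ 𝒜)) := by
      refine ⟨⟨_, hy⟩, Subtype.ext ?_⟩
      have hc' := congrArg (algebraMap R (FractionRing R)) hc
      rw [map_mul, map_mul] at hc'
      change algebraMap R (FractionRing R) g * _ * (algebraMap R (FractionRing R) g' * _) =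
        (π : FractionRing R) * _
      rw [hπq]
      have h1 := ne hs0
      have h2 := ne ht0
      have h3 := ne hr0
      have h4 := ne hr0'
      field_simp
      exact hc'
    exact (hπ.dvd_or_dvd hdvd).imp (key g r hx ⟨i, hr⟩ hr0) (key g' r' hx' ⟨i', hr'⟩ hr0')

theorem FactoriallyGradedA.exists_mul_eq_hasGradedPrimeFactorization
    (hfac : FactoriallyGradedA 𝒜) (hK : AddGroup.FG K)
    (hker : ∀ k : K, IsOfFinAddOrder k → φ k = 0 → k = 0)
    (x : fracRing φ 𝒜 (coarsenGrading φ 𝒜)) (hx : x ≠ 0) :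
    ∃ t g, IsHomogA 𝒜 t ∧ t ≠ 0 ∧ HasGradedPrimeFactorization (coarsenGrading φ 𝒜) g ∧
      (x : FractionRing R) * algebraMap R _ t = algebraMap R _ g := by
  have inj := IsFractionRing.injective R (FractionRing R)
  have := uniqueFactorizationMonoid_fracRing φ 𝒜 hK hker
  induction x using UniqueFactorizationMonoid.induction_on_prime with
  | h₁ => exact absurd rfl hx
  | h₂ x hu =>
    obtain ⟨y, hxy⟩ := hu.exists_right_inv
    obtain ⟨⟨x, k, s, hs, a, ha, hs0, hxa⟩, rfl⟩ : ∃ z, z = x := ⟨x, rfl⟩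
    obtain ⟨y, l, t, ht, b, hb, ht0, hyb⟩ := y
    have hxy' : x * y = 1 := congrArg Subtype.val hxy
    have hab : a * b = s * t := by
      refine inj ?_
      rw [map_mul, map_mul, ← hxa, ← hyb]
      linear_combination (algebraMap R (FractionRing R) s * algebraMap R _ t) * hxy'
    have hst0 := mul_ne_zero hs0 ht0
    obtain ⟨r, v, hr, hr0, hv, rfl⟩ := hfac.exists_eq_mul_unit_of_mul hK hker ⟨_, ha⟩
      (hab ▸ isHomogA_mul 𝒜 ⟨k, hs⟩ ⟨l, ht⟩) (hab ▸ hst0)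
    exact ⟨s, r * v, ⟨k, hs⟩, hs0,
      (hfac.hasGradedPrimeFactorization_coarsen hK hker hr hr0).mul (.of_isUnit hv), hxa⟩
  | h₃ x π hx0 hπ ih =>
    obtain ⟨t, g, ht, ht0, hg, h⟩ := ih hx0
    obtain ⟨l, b, hb, a, ha, hb0, hπa⟩ := mem_fracPart.mp (mem_fracRing.mp π.2)
    have ha0 : a ≠ 0 := by
      rintro rfl
      rw [map_zero, mul_eq_zero] at hπa
      exact hπa.elim (fun h0 => hπ.ne_zero (Subtype.ext h0)) (by simpa using hb0)
    rw [zero_add] at ha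
    obtain ⟨k, s, hs, q, hq, hs0, rfl, hqp⟩ := hfac.exists_eq_mul_not_dvd ha ha0
    have hqprime := hfac.isGradedPrimeA_of_prime hK hker hπ hs hs0 hb hb0 hq hqp hπa
    refine ⟨b * t, s * q * g, isHomogA_mul 𝒜 ⟨l, hb⟩ ht, mul_ne_zero hb0 ht0,
      ((hfac.hasGradedPrimeFactorization_coarsen hK hker ⟨k, hs⟩ hs0).mul
        hqprime.hasGradedPrimeFactorization).mul hg, ?_⟩
    rw [map_mul, map_mul (algebraMap R (FractionRing R)) (s * q), ← hπa, ← h]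
    change (π : FractionRing R) * x * _ = _
    ring

end Main

theorem factoriallyGraded_of_change_of_free_part
    (K K' R : Type) [AddCommGroup K] [AddCommGroup K'] [DecidableEq K]
    (hK : AddGroup.FG K) (hK' : AddGroup.FG K')
    [CommRing R] [IsDomain R]
    (𝒜 : K → AddSubgroup R) [GradedRing 𝒜]
    (hfac : FactoriallyGradedA 𝒜)
    (φ : K →+ K')
    (hsurj : Function.Surjective φ)
    (htorsKer : ∀ k : K, IsOfFinAddOrder k → φ k = 0 → k = 0)
    (htorsSurj : ∀ k' : K', IsOfFinAddOrder k' → ∃ k : K, IsOfFinAddOrder k ∧ φ k = k') :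
    FactoriallyGradedA (coarsenGrading φ 𝒜) := by
  classical
  rintro f ⟨w, hf⟩ hf0 hfu
  refine HasGradedPrimeFactorization.exists_eq_prod ?_ ⟨w, hf⟩ hfu
  obtain ⟨k, rfl, s, hs, hs0⟩ := exists_mem_ne_zero_of_mem_coarsenGrading hf hf0
  have hs0' : algebraMap R (FractionRing R) s ≠ 0 := by simpa using hs0
  have hx := mul_mem_fracPart (algebraMap_mem_fracPart (φ := φ) (𝒜 := 𝒜) hf)
    (inv_algebraMap_mem_fracPart hs)
  rw [add_neg_cancel] at hx
  obtain ⟨t, g, ht, ht0, hg, h⟩ := hfac.exists_mul_eq_hasGradedPrimeFactorization hK htorsKer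
    ⟨_, hx⟩ (fun h0 => mul_ne_zero (by simpa using hf0) (inv_ne_zero hs0')
      (congrArg Subtype.val h0))
  have hft : t * f = s * g := by
    refine IsFractionRing.injective R (FractionRing R) ?_
    rw [map_mul, map_mul, ← h]
    field_simp
  obtain ⟨u, m, hu, hm, rfl⟩ := hfac.hasGradedPrimeFactorization ht ht0
  obtain ⟨v, hv⟩ := hu.exists_left_inv
  refine HasGradedPrimeFactorization.of_mul_left
    (fun p hp => (hm p hp).coarsen (φ := φ) hK htorsKer) ?_
  have : m.prod * f = v * (s * g) := by
    rw [← hft]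
    linear_combination (-(m.prod * f)) * hv
  rw [this]
  exact .mul (.of_isUnit (.of_mul_eq_one u hv))
    ((hfac.hasGradedPrimeFactorization_coarsen hK htorsKer ⟨k, hs⟩ hs0).mul hg)
end
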